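/- arXiv:1703.07906 — 2 statements merged into one kernel-verified Lean document; each statement's English description precedes it below -/
import Mathlib

section
/- Let A be a finite-dimensional algebra over an algebraically closed field, and let 0 → L →^f Y →^g τ^{-1}L → 0 be an almost split sequence where Y ≅ ⊕_{X ∈ J_L} X^{a(X)} with J_L a finite set of pairwise non-isomorphic indecomposables and a(X) ≥ 1. Then for every finite-dimensional A-module M, the multiplicity of L in M satisfies d_M(L) = dim Hom_A(L,M) - Σ_{X∈J_L} a(X)·dim Hom_A(X,M) + dim Hom_A(τ^{-1}L, M). -/
/-- A module is indecomposable if it is nonzero and admits no nontrivial direct sum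
decomposition. -/
def IsIndecomposableModule (A : Type) (L : Type) [Ring A] [AddCommGroup L]
    [Module A L] : Prop :=
  Nontrivial L ∧ ∀ p q : Submodule A L, IsCompl p q → p = ⊥ ∨ q = ⊥

open Classical

/-- if `v r = id` and `v` is not injective then the module is decomposable. -/
theorem aux_retract {A C Z : Type} [Ring A] [AddCommGroup C] [Module A C]
    [AddCommGroup Z] [Module A Z]
    (hC : IsIndecomposableModule A C) (hZ : Nontrivial Z) (v : C →ₗ[A] Z) (r : Z →ₗ[A] C)
    (h : v ∘ₗ r = LinearMap.id) : Function.Injective v := by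
  have h' : ∀ x, v (r x) = x := fun x => LinearMap.congr_fun h x
  have hc : IsCompl (LinearMap.ker v) (LinearMap.range r) := by
    constructor
    · rw [Submodule.disjoint_def]
      rintro x hx ⟨y, rfl⟩
      have : y = 0 := by rw [← h' y]; exact hx
      simp [this]
    · rw [codisjoint_iff, eq_top_iff]
      intro x _
      rw [Submodule.mem_sup]
      refine ⟨x - r (v x), ?_, r (v x), ⟨v x, rfl⟩, by simp⟩
      simp [h']
  rcases hC.2 _ _ hc with h0 | h0
  · exact LinearMap.ker_eq_bot.1 h0
  · exfalso
    obtain ⟨z, hz⟩ := exists_ne (0 : Z)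
    apply hz
    rw [← h' z]
    have : r z ∈ LinearMap.range r := ⟨z, rfl⟩
    rw [h0, Submodule.mem_bot] at this
    simp [this]

noncomputable def TreeLab (Base I : Type) [LinearOrder I] [WellFoundedLT I] : I → Type :=
  WellFounded.fix (C := fun _ => Type) (wellFounded_lt (α := I))
    (fun i ih => Set (Base × (∀ j : Set.Iio i, ih j.1 j.2)))

theorem TreeLab_eq (Base I : Type) [LinearOrder I] [WellFoundedLT I] (i : I) :
    TreeLab Base I i = Set (Base × (∀ j : Set.Iio i, TreeLab Base I j.1)) := by
  unfold TreeLab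
  rw [WellFounded.fix_eq]

theorem exists_tree (I Q Y : Type) [LinearOrder I] [WellFoundedLT I] [NoMaxOrder I] :
    ∃ (P : I → Type) (B : Type) (r : ∀ i, B → P i),
      (∀ i j b b', i ≤ j → r j b = r j b' → r i b = r i b') ∧
      (∀ b b', b ≠ b' → ∃ i, r i b ≠ r i b') ∧
      (∀ Φ : Set B → ((i : I) → P i → Q → Y), ¬ Function.Injective Φ) := by
  let T := TreeLab (Q × Y) I
  refine ⟨fun i => ∀ j : Set.Iio i, T j.1, ∀ i, T i, fun i b j => b j.1, ?_, ?_, ?_⟩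
  · intro i j b b' hij h
    funext l
    exact congr_fun h ⟨l.1, lt_of_lt_of_le l.2 hij⟩
  · intro b b' h
    obtain ⟨j, hj⟩ := Function.ne_iff.1 h
    obtain ⟨i, hi⟩ := exists_gt j
    exact ⟨i, fun h' => hj (congr_fun h' ⟨j, hi⟩)⟩
  · intro Φ hΦ
    let G : ((i : I) → (∀ j : Set.Iio i, T j.1) → Q → Y) → ∀ i, T i := fun φ i =>
      cast (TreeLab_eq (Q × Y) I i).symm {z | φ i z.2 z.1.1 = z.1.2}
    have hG : Function.Injective G := by
      intro φ ψ h
      funext i p q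
      have h1 := congr_fun h i
      have h2 := (cast_bijective _).injective h1
      have h3 : ((q, φ i p q), p) ∈ {z : (Q × Y) × (∀ j : Set.Iio i, T j.1) | ψ i z.2 z.1.1 = z.1.2} := by
        rw [← h2]; rfl
      exact h3.symm
    exact Function.cantor_injective _ (hG.comp hΦ)

theorem no_chain {A C Y I : Type} [Ring A] [AddCommGroup C] [Module A C]
    [AddCommGroup Y] [Module A Y] (g : Y →ₗ[A] C)
    (hnonsplit : ¬ ∃ s : C →ₗ[A] Y, g ∘ₗ s = LinearMap.id)
    (hC : IsIndecomposableModule A C)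
    (hright : ∀ (Z : Type) [AddCommGroup Z] [Module A Z] (h : Z →ₗ[A] C),
      ¬ (∃ s : C →ₗ[A] Z, h ∘ₗ s = LinearMap.id) → ∃ u : Z →ₗ[A] Y, g ∘ₗ u = h)
    [LinearOrder I] [WellFoundedLT I] (N : I → Submodule A C) (hN : Monotone N)
    (hNp : ∀ i, N i ≠ ⊤) (hNt : ∀ c, ∃ i, c ∈ N i) : False := by
  have : NoMaxOrder I := by
    constructor
    intro j
    obtain ⟨c, hc⟩ : ∃ c, c ∉ N j := by
      by_contra! h
      exact hNp j (eq_top_iff.2 fun c _ => h c)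
    obtain ⟨i, hi⟩ := hNt c
    refine ⟨i, ?_⟩
    by_contra! h
    exact hc (hN h hi)
  obtain ⟨i₀, -⟩ := hNt 0
  have : Nonempty I := ⟨i₀⟩
  obtain ⟨P, B, r, hr1, hr2, hr3⟩ := exists_tree I (I × C) Y
  let E : B → I → C →ₗ[A] (((n : (Σ i, P i)) → C) × (B →₀ C)) := fun b i =>
    LinearMap.prod (LinearMap.pi fun n => if i ≤ n.1 ∧ n.2 = r n.1 b then LinearMap.id else 0)
      (Finsupp.lsingle b)
  have hE1 : ∀ b i c n, (E b i c).1 n = if i ≤ n.1 ∧ n.2 = r n.1 b then c else 0 := by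
    intro b i c n
    change (if i ≤ n.1 ∧ n.2 = r n.1 b then (LinearMap.id : C →ₗ[A] C) else 0) c = _
    split_ifs <;> simp
  have hE2 : ∀ b i c, (E b i c).2 = Finsupp.single b c := fun b i c => rfl
  let T : Submodule A (((n : (Σ i, P i)) → C) × (B →₀ C)) :=
    Submodule.span A {v | ∃ b i, ∃ c ∈ N i, v = E b i c}
  have hET : ∀ b i c, c ∈ N i → E b i c ∈ T := fun b i c hc =>
    Submodule.subset_span ⟨b, i, c, hc, rfl⟩
  have hT1 : ∀ x ∈ T, ∀ n : (Σ i, P i), x.1 n ∈ N n.1 := by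
    intro x hx n
    induction hx using Submodule.span_induction with
    | mem x h =>
      obtain ⟨b, i, c, hc, rfl⟩ := h
      rw [hE1]
      split_ifs with h
      · exact hN h.1 hc
      · exact zero_mem _
    | zero => exact zero_mem _
    | add x y _ _ hx hy => exact add_mem hx hy
    | smul a x _ hx => exact Submodule.smul_mem _ a hx
  have hT2 : ∀ x ∈ T, ∃ i, ∀ j, i ≤ j → ∀ n : P j,
      x.1 ⟨j, n⟩ = Finsupp.mapDomain (r j) x.2 n := by
    intro x hx
    induction hx using Submodule.span_induction with
    | mem x h =>
      obtain ⟨b, i, c, hc, rfl⟩ := h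
      refine ⟨i, fun j hj n => ?_⟩
      rw [hE1, hE2, Finsupp.mapDomain_single, Finsupp.single_apply]
      simp [hj, eq_comm]
    | zero => exact ⟨i₀, by simp⟩
    | add x y _ _ hx hy =>
      obtain ⟨i, hi⟩ := hx
      obtain ⟨j, hj⟩ := hy
      refine ⟨max i j, fun l hl n => ?_⟩
      have h1 := hi l (le_trans (le_max_left _ _) hl) n
      have h2 := hj l (le_trans (le_max_right _ _) hl) n
      simp [Finsupp.mapDomain_add, h1, h2]
    | smul a x _ hx =>
      obtain ⟨i, hi⟩ := hx
      refine ⟨i, fun l hl n => ?_⟩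
      simp [Finsupp.mapDomain_smul, hi l hl n]
  have hsep : ∀ (F : Finset B) (i : I), ∃ j, i ≤ j ∧ Set.InjOn (r j) (F : Set B) := by
    intro F i
    have h1 : ∀ p : B × B, ∃ l, p.1 ≠ p.2 → r l p.1 ≠ r l p.2 := by
      intro p
      by_cases h : p.1 = p.2
      · exact ⟨i₀, fun h' => absurd h h'⟩
      · obtain ⟨l, hl⟩ := hr2 _ _ h
        exact ⟨l, fun _ => hl⟩
    choose l hl using h1
    obtain ⟨j, hj⟩ := Finset.exists_le (insert i ((F ×ˢ F).image l))
    refine ⟨j, hj i (by simp), ?_⟩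
    intro b hb b' hb' h
    by_contra hne
    apply hl (b, b') hne
    refine hr1 _ _ _ _ (hj _ ?_) h
    refine Finset.mem_insert_of_mem (Finset.mem_image_of_mem _ ?_)
    simpa using ⟨hb, hb'⟩
  let p : Set B → T →ₗ[A] C := fun S =>
    (Finsupp.lsum ℕ (fun b => if b ∈ S then (LinearMap.id : C →ₗ[A] C) else 0)) ∘ₗ
      (LinearMap.snd A _ _) ∘ₗ T.subtype
  have hp : ∀ S (x : T), p S x = ∑ b ∈ x.1.2.support with b ∈ S, x.1.2 b := by
    intro S x
    simp only [p, LinearMap.comp_apply, Finsupp.lsum_apply, Finsupp.sum, Finset.sum_filter]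
    refine Finset.sum_congr rfl fun b _ => ?_
    split_ifs <;> simp
  have hns : ∀ S, ¬ ∃ s : C →ₗ[A] T, p S ∘ₗ s = LinearMap.id := by
    rintro S ⟨s, hs⟩
    obtain ⟨c, hc⟩ := @exists_ne _ hC.1 (0 : C)
    obtain ⟨i, hi⟩ := hT2 _ (s c).2
    obtain ⟨j, hij, hj⟩ := hsep (s c).1.2.support i
    let F : Finset (P j) := ((s c).1.2.support.filter (· ∈ S)).image (r j)
    let q : T →ₗ[A] C := (∑ n ∈ F, LinearMap.proj (R := A) (φ := fun _ : (Σ i, P i) => C) ⟨j, n⟩) ∘ₗ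
      (LinearMap.fst A _ _) ∘ₗ T.subtype
    have hq : ∀ x : T, q x = ∑ n ∈ F, x.1.1 ⟨j, n⟩ := by
      intro x; simp [q]
    have hqc : q (s c) = c := by
      have h1 : p S (s c) = c := LinearMap.congr_fun hs c
      rw [hq]
      conv_rhs => rw [← h1]
      rw [hp, Finset.sum_image]
      · refine Finset.sum_congr rfl fun b hb => ?_
        rw [hi j hij]
        exact Finsupp.mapDomain_apply' (s c).1.2.support _ (le_refl _) hj (Finset.mem_filter.1 hb).1
      · intro b hb b' hb' h
        exact hj (Finset.mem_filter.1 hb).1 (Finset.mem_filter.1 hb').1 h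
    have hqN : ∀ x, q x ∈ N j := by
      intro x
      rw [hq]
      exact sum_mem fun n _ => hT1 _ x.2 ⟨j, n⟩
    obtain ⟨u, hu⟩ := hright C (q ∘ₗ s) (by
      rintro ⟨t, ht⟩
      refine hNp j (eq_top_iff.2 fun x _ => ?_)
      have := LinearMap.congr_fun ht x
      simp only [LinearMap.comp_apply, LinearMap.id_apply] at this
      rw [← this]; exact hqN _)
    obtain ⟨u', hu'⟩ := hright C (LinearMap.id - q ∘ₗ s) (by
      rintro ⟨t, ht⟩
      have := aux_retract hC hC.1 _ _ ht
      exact hc (this (by simp [hqc])))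
    exact hnonsplit ⟨u + u', by rw [LinearMap.comp_add, hu, hu']; abel⟩
  choose u hu using fun S => hright T (p S) (hns S)
  have hd : ∀ b b' i j c, i ≤ j → r j b = r j b' → 
      E b i c - E b j c = E b' i c - E b' j c := by
    intro b b' i j c hij h
    refine Prod.ext ?_ ?_
    · funext n
      simp only [Prod.fst_sub, Pi.sub_apply, hE1]
      by_cases hn : j ≤ n.1
      · simp [hn, hij.trans hn]
      · rw [hr1 n.1 j b b' (le_of_not_ge hn) h]
    · simp [hE2]
  let code : Set B → ((i : I) → P i → (I × C) → Y) := fun S j n z =>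
    if h : ∃ b, r j b = n ∧ z.1 ≤ j ∧ z.2 ∈ N z.1 ∧ z.2 ∈ N j then
      u S (⟨E h.choose z.1 z.2, hET _ _ _ h.choose_spec.2.2.1⟩ -
        ⟨E h.choose j z.2, hET _ _ _ h.choose_spec.2.2.2⟩)
    else 0
  have hcode : ∀ S b i j c (hij : i ≤ j) (hc : c ∈ N i),
      code S j (r j b) (i, c) = u S ⟨E b i c, hET _ _ _ hc⟩ - u S ⟨E b j c, hET _ _ _ (hN hij hc)⟩ := by
    intro S b i j c hij hc
    have h : ∃ b', r j b' = r j b ∧ i ≤ j ∧ c ∈ N i ∧ c ∈ N j := ⟨b, rfl, hij, hc, hN hij hc⟩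
    simp only [code]
    rw [dif_pos h, ← map_sub]
    congr 1
    apply Subtype.ext
    exact hd _ _ _ _ _ hij h.choose_spec.1
  have key : ∀ S S' b, code S = code S' → b ∈ S → b ∉ S' → False := by
    intro S S' b hSS hb hb'
    let v := u S - u S'
    have hv : ∀ i j c (hij : i ≤ j) (hc : c ∈ N i),
        v ⟨E b i c, hET _ _ _ hc⟩ = v ⟨E b j c, hET _ _ _ (hN hij hc)⟩ := by
      intro i j c hij hc
      have h1 := hcode S b i j c hij hc
      have h2 := hcode S' b i j c hij hc
      rw [hSS, h2] at h1
      simp only [v, LinearMap.sub_apply]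
      rw [← sub_eq_zero] at h1 ⊢
      rw [← neg_eq_zero, ← h1]
      abel
    choose ix hix using hNt
    have hvi : ∀ i c (hc : c ∈ N i), v ⟨E b i c, hET _ _ _ hc⟩ = v ⟨E b (ix c) c, hET _ _ _ (hix c)⟩ := by
      intro i c hc
      rcases le_total i (ix c) with h | h
      · exact hv _ _ c h hc
      · exact (hv _ _ c h (hix c)).symm
    apply hnonsplit
    refine ⟨{ toFun := fun c => v ⟨E b (ix c) c, hET _ _ _ (hix c)⟩, map_add' := ?_, map_smul' := ?_}, ?_⟩
    · intro c d
      let j := max (ix c) (ix d)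
      have h1 : c ∈ N j := hN (le_max_left _ _) (hix c)
      have h2 : d ∈ N j := hN (le_max_right _ _) (hix d)
      rw [← hvi j c h1, ← hvi j d h2, ← hvi j _ (add_mem h1 h2), ← map_add]
      congr 1
      apply Subtype.ext
      simp
    · intro a c
      rw [← hvi (ix c) _ (Submodule.smul_mem _ a (hix c)), RingHom.id_apply, ← map_smul]
      congr 1
      apply Subtype.ext
      simp
    · ext c
      have h1 : ∀ S x, g (u S x) = p S x := fun S x => LinearMap.congr_fun (hu S) x
      simp only [LinearMap.comp_apply, LinearMap.coe_mk, AddHom.coe_mk, v, LinearMap.sub_apply, map_sub, h1,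
        LinearMap.id_apply]
      have h2 : ∀ S, p S ⟨E b (ix c) c, hET _ _ _ (hix c)⟩ = if b ∈ S then c else 0 := by
        intro S
        simp only [p, LinearMap.comp_apply, Submodule.subtype_apply, LinearMap.snd_apply, hE2]
        rw [Finsupp.lsum_single]
        split_ifs <;> simp
      rw [h2, h2, if_pos hb, if_neg hb', sub_zero]
  refine hr3 code fun S S' h => ?_
  ext b
  constructor
  · intro hb; by_contra hb'; exact key S S' b h hb hb'
  · intro hb; by_contra hb'; exact key S' S b h.symm hb hb'

open Cardinal in
theorem finite_right {A C Y : Type} [Ring A] [AddCommGroup C] [Module A C]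
    [AddCommGroup Y] [Module A Y] (g : Y →ₗ[A] C)
    (hnonsplit : ¬ ∃ s : C →ₗ[A] Y, g ∘ₗ s = LinearMap.id)
    (hC : IsIndecomposableModule A C)
    (hright : ∀ (Z : Type) [AddCommGroup Z] [Module A Z] (h : Z →ₗ[A] C),
      ¬ (∃ s : C →ₗ[A] Z, h ∘ₗ s = LinearMap.id) → ∃ u : Z →ₗ[A] Y, g ∘ₗ u = h) :
    Module.Finite A C := by
  by_contra hfin
  let Sc : Set Cardinal.{0} := {c | ∃ G : Set C, #G = c ∧ Submodule.span A G = ⊤}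
  have hne : Sc.Nonempty := ⟨_, Set.univ, rfl, Submodule.span_univ⟩
  obtain ⟨c, ⟨G, hGc, hG⟩, hmin⟩ := WellFounded.has_min (wellFounded_lt (α := Cardinal.{0})) Sc hne
  have hinf : ℵ₀ ≤ c := by
    by_contra! h
    apply hfin
    rw [← hGc, Cardinal.lt_aleph0_iff_set_finite] at h
    exact ⟨⟨h.toFinset, by simpa using hG⟩⟩
  have hI : #c.ord.ToType = c := Cardinal.mk_ord_toType c
  obtain ⟨e⟩ : Nonempty (c.ord.ToType ≃ G) := Cardinal.eq.1 (hI.trans hGc.symm)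
  let N : c.ord.ToType → Submodule A C := fun i =>
    Submodule.span A ((fun j => (e j : C)) '' Set.Iic i)
  have hmono : Monotone N := fun i j hij =>
    Submodule.span_mono (Set.image_mono (Set.Iic_subset_Iic.2 hij))
  refine no_chain g hnonsplit hC hright N hmono ?_ ?_
  · intro i hi
    refine hmin _ ⟨_, rfl, hi⟩ ?_
    refine lt_of_le_of_lt Cardinal.mk_image_le ?_
    have := Cardinal.mk_Iic_lt i (by simp) (by rw [hI]; exact hinf)
    rwa [hI] at this
  · have hne : Nonempty c.ord.ToType := by
      rw [← Cardinal.mk_ne_zero_iff, hI]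
      rintro rfl
      exact absurd (lt_of_lt_of_le Cardinal.aleph0_pos hinf) (lt_irrefl _)
    intro x
    have hx : x ∈ Submodule.span A G := by rw [hG]; trivial
    have hle : Submodule.span A G ≤ ⨆ i, N i := by
      rw [Submodule.span_le]
      intro y hy
      refine Submodule.mem_iSup_of_mem (e.symm ⟨y, hy⟩) (Submodule.subset_span ?_)
      exact ⟨e.symm ⟨y, hy⟩, Set.self_mem_Iic, by simp⟩
    exact (Submodule.mem_iSup_of_directed N hmono.directed_le).1 (hle hx)

theorem finite_left {k A C Y L : Type} [Field k] [Ring A] [Algebra k A] [FiniteDimensional k A]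
    [AddCommGroup C] [Module A C]
    [AddCommGroup Y] [Module A Y] [AddCommGroup L] [Module A L] [Module k L] [IsScalarTower k A L]
    (f : L →ₗ[A] Y) (g : Y →ₗ[A] C)
    (hf : Function.Injective f) (hg : Function.Surjective g)
    (hexact : LinearMap.range f = LinearMap.ker g)
    (hnonsplit : ¬ ∃ s : C →ₗ[A] Y, g ∘ₗ s = LinearMap.id)
    (hleft : ∀ (Z : Type) [AddCommGroup Z] [Module A Z] (h : L →ₗ[A] Z),
      ¬ (∃ r : Z →ₗ[A] L, r ∘ₗ h = LinearMap.id) → ∃ u : Y →ₗ[A] Z, u ∘ₗ f = h)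
    [Module.Finite A C] : Module.Finite A L := by
  by_contra hfin
  have hnoeth : IsNoetherianRing A := isNoetherian_of_tower k (inferInstance : IsNoetherian k A)
  have : SMulCommClass A k L := IsScalarTower.to_smulCommClass'
  obtain ⟨n, π, hπ⟩ := Module.Finite.exists_fin' A C
  obtain ⟨π', hπ'⟩ := Module.projective_lifting_property g π hg
  have hπ'' : ∀ x, g (π' x) = π x := fun x => LinearMap.congr_fun hπ' x
  let K := LinearMap.ker π
  let eL := LinearEquiv.ofInjective f hf
  let ψ : K →ₗ[A] L := eL.symm.toLinearMap ∘ₗ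
    LinearMap.codRestrict (LinearMap.range f) (π' ∘ₗ K.subtype) (by
      intro x
      rw [hexact, LinearMap.mem_ker]
      simp only [LinearMap.comp_apply, Submodule.subtype_apply, hπ'']
      exact x.2)
  have hψ : ∀ x : K, f (ψ x) = π' x := by
    intro x
    have : ∀ y, f (eL.symm y) = y := fun y => by
      have := congrArg Subtype.val (eL.apply_symm_apply y)
      exact this
    simp [ψ, this]
  have hno : ∀ θ : (Fin n → A) →ₗ[A] L, ¬ ∀ x : K, θ x = ψ x := by
    intro θ hθ
    apply hnonsplit
    let σ := K.liftQ (π' - f ∘ₗ θ) (by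
      intro x hx
      have := hθ ⟨x, hx⟩
      simp only at this
      simp [this, hψ])
    refine ⟨σ ∘ₗ (LinearMap.quotKerEquivOfSurjective π hπ).symm.toLinearMap, ?_⟩
    ext c
    obtain ⟨x, rfl⟩ := hπ c
    have h1 : (LinearMap.quotKerEquivOfSurjective π hπ).symm (π x) = K.mkQ x := by
      rw [LinearEquiv.symm_apply_eq]; rfl
    have h2 : ∀ y, g (f y) = 0 := fun y => by
      have : f y ∈ LinearMap.ker g := hexact ▸ ⟨y, rfl⟩
      exact this
    simp [h1, σ, h2, hπ'']
  have : Module.Finite A K := inferInstance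
  obtain ⟨r, κ, hκ⟩ := Module.Finite.exists_fin (R := A) (M := K)
  let ev : ((Fin n → A) →ₗ[A] L) →ₗ[k] (Fin r → L) :=
    { toFun := fun θ i => θ (κ i)
      map_add' := fun _ _ => rfl
      map_smul' := fun _ _ => rfl }
  have hnot : (fun i => ψ (κ i)) ∉ LinearMap.range ev := by
    rintro ⟨θ, hθ⟩
    apply hno θ
    have : θ ∘ₗ K.subtype = ψ := by
      apply LinearMap.ext_on_range hκ
      intro i
      exact congr_fun hθ i
    intro x
    exact LinearMap.congr_fun this x
  obtain ⟨l, hl, hle⟩ := Submodule.exists_le_ker_of_notMem hnot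
  let μ : L →ₗ[k] (Fin r → A →ₗ[k] k) := LinearMap.pi fun i =>
    { toFun := fun x => 
        { toFun := fun a => l (Pi.single i (a • x))
          map_add' := by intro a b; rw [add_smul, Pi.single_add, map_add]
          map_smul' := by intro c a; rw [smul_assoc, Pi.single_smul, map_smul]; rfl }
      map_add' := by
        intro x y; ext a
        simp [Pi.single_add]
      map_smul' := by
        intro c x; ext a
        change l (Pi.single i (a • c • x)) = c • l (Pi.single i (a • x))
        rw [smul_comm, Pi.single_smul, map_smul] }
  have hμ : ∀ x i a, μ x i a = l (Pi.single i (a • x)) := fun _ _ _ => rfl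
  let N : Submodule A L :=
    { carrier := {x | μ x = 0}
      add_mem' := by
        intro x y hx hy
        simp only [Set.mem_ofPred_eq] at *
        rw [map_add, hx, hy, add_zero]
      zero_mem' := by simp
      smul_mem' := by
        intro a x hx
        simp only [Set.mem_ofPred_eq] at *
        funext i
        ext b
        rw [hμ, smul_smul, ← hμ, hx]
        rfl }
  have hNk : N.restrictScalars k = LinearMap.ker μ := by
    ext x; rfl
  have hfq : Module.Finite k (L ⧸ N) := by
    have h1 : Module.Finite k (L ⧸ LinearMap.ker μ) :=
      Module.Finite.equiv μ.quotKerEquivRange.symm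
    rw [← hNk] at h1
    exact Module.Finite.equiv (Submodule.Quotient.restrictScalarsEquiv k N)
  have hfqA : Module.Finite A (L ⧸ N) := Module.Finite.of_restrictScalars_finite k A _
  obtain ⟨u, hu⟩ := hleft (L ⧸ N) N.mkQ (by
    rintro ⟨s, hs⟩
    apply hfin
    exact Module.Finite.of_surjective s (fun x => ⟨N.mkQ x, LinearMap.congr_fun hs x⟩))
  obtain ⟨θ, hθ⟩ := Module.projective_lifting_property N.mkQ (u ∘ₗ π') N.mkQ_surjective
  have hd : ∀ x : K, θ x - ψ x ∈ N := by
    intro x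
    rw [← Submodule.Quotient.mk_eq_zero, Submodule.Quotient.mk_sub, sub_eq_zero]
    have h1 : N.mkQ (θ x) = u (π' x) := LinearMap.congr_fun hθ x
    have h2 : u (f (ψ x)) = N.mkQ (ψ x) := LinearMap.congr_fun hu (ψ x)
    rw [hψ] at h2
    exact h1.trans h2
  have h0 : l (ev θ) = 0 := hle ⟨θ, rfl⟩
  have h1 : l (ev θ - fun i => ψ (κ i)) = 0 := by
    rw [← Finset.univ_sum_single (ev θ - fun i => ψ (κ i)), map_sum]
    refine Finset.sum_eq_zero fun i _ => ?_
    have h2 : μ (θ (κ i) - ψ (κ i)) = 0 := hd (κ i)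
    have h3 := hμ (θ (κ i) - ψ (κ i)) i 1
    rw [h2, one_smul] at h3
    exact h3.symm
  rw [map_sub, h0, zero_sub, neg_eq_zero] at h1
  exact hl h1

theorem finite_hom (k : Type) {A X M : Type} [Field k] [Ring A] [Algebra k A]
    [AddCommGroup X] [Module A X] [AddCommGroup M] [Module A M] [Module k M] 
    [SMulCommClass A k M] [FiniteDimensional k M] [Module.Finite A X] :
    Module.Finite k (X →ₗ[A] M) := by
  obtain ⟨r, κ, hκ⟩ := Module.Finite.exists_fin (R := A) (M := X)
  let ev : (X →ₗ[A] M) →ₗ[k] (Fin r → M) :=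
    { toFun := fun θ i => θ (κ i)
      map_add' := fun _ _ => rfl
      map_smul' := fun _ _ => rfl }
  refine Module.Finite.of_injective ev fun θ θ' h => ?_
  exact LinearMap.ext_on_range hκ fun i => congr_fun h i

theorem exists_functional {k A Y L : Type} [Field k] [IsAlgClosed k] [Ring A] [Algebra k A]
    [AddCommGroup Y] [Module A Y] [AddCommGroup L] [Module A L] [Module k L] [IsScalarTower k A L]
    [SMulCommClass A k L] [FiniteDimensional k L] [Nontrivial L]
    (f : L →ₗ[A] Y)
    (hns : ¬ ∃ u : Y →ₗ[A] L, u ∘ₗ f = LinearMap.id)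
    (hleft : ∀ (Z : Type) [AddCommGroup Z] [Module A Z] (h : L →ₗ[A] Z),
      ¬ (∃ r : Z →ₗ[A] L, r ∘ₗ h = LinearMap.id) → ∃ u : Y →ₗ[A] Z, u ∘ₗ f = h) :
    ∃ t : (L →ₗ[A] L) →ₗ[k] k, t LinearMap.id ≠ 0 ∧
      ∀ h, t h = 0 ↔ ∃ u : Y →ₗ[A] L, u ∘ₗ f = h := by
  have hid : (LinearMap.id : L →ₗ[A] L) ∉ LinearMap.range (LinearMap.lcomp k L f) := by
    rintro ⟨u, hu⟩
    exact hns ⟨u, hu⟩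
  obtain ⟨t, ht, hle⟩ := Submodule.exists_le_ker_of_notMem hid
  have hrad : ∀ h : L →ₗ[A] L, (∃ u : Y →ₗ[A] L, u ∘ₗ f = h) → t h = 0 := by
    rintro h ⟨u, rfl⟩
    exact hle ⟨u, rfl⟩
  refine ⟨t, ht, fun h => ⟨fun hh => ?_, hrad h⟩⟩
  obtain ⟨c, hc⟩ := Module.End.exists_eigenvalue (h.restrictScalars k : L →ₗ[k] L)
  obtain ⟨x, hx⟩ := hc.exists_hasEigenvector
  have hx1 : h x = c • x := hx.apply_eq_smul
  have hu := hleft L (h - c • LinearMap.id) (by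
    rintro ⟨r, hr⟩
    have := LinearMap.congr_fun hr x
    simp [hx1] at this
    exact hx.2 this.symm)
  have h1 := hrad _ hu
  rw [map_sub, hh, map_smul, zero_sub, neg_eq_zero, smul_eq_mul, mul_eq_zero] at h1
  have hc0 := h1.resolve_right ht
  simpa [hc0] using hu


theorem nonsplit_left {A C Y L : Type} [Ring A]
    [AddCommGroup C] [Module A C]
    [AddCommGroup Y] [Module A Y] [AddCommGroup L] [Module A L]
    (f : L →ₗ[A] Y) (g : Y →ₗ[A] C) (hg : Function.Surjective g)
    (hexact : LinearMap.range f = LinearMap.ker g)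
    (hnonsplit : ¬ ∃ s : C →ₗ[A] Y, g ∘ₗ s = LinearMap.id) :
    ¬ ∃ u : Y →ₗ[A] L, u ∘ₗ f = LinearMap.id := by
  rintro ⟨u, hu⟩
  apply hnonsplit
  let σ := (LinearMap.ker g).liftQ (LinearMap.id - f ∘ₗ u) (by
    rw [← hexact]
    rintro _ ⟨x, rfl⟩
    have : u (f x) = x := LinearMap.congr_fun hu x
    simp [this])
  refine ⟨σ ∘ₗ (LinearMap.quotKerEquivOfSurjective g hg).symm.toLinearMap, ?_⟩
  ext c
  obtain ⟨x, rfl⟩ := hg c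
  have h1 : (LinearMap.quotKerEquivOfSurjective g hg).symm (g x) = (LinearMap.ker g).mkQ x := by
    rw [LinearEquiv.symm_apply_eq]; rfl
  have h2 : ∀ y, g (f y) = 0 := fun y => by
    have : f y ∈ LinearMap.ker g := hexact ▸ ⟨y, rfl⟩
    exact this
  simp [h1, σ, h2]

/-- let `0 → L →f Y →g C → 0` (with `C = τ⁻¹ L`) be an almost split
sequence over a finite-dimensional algebra `A` over an algebraically closed field `k`,
with `Y ≅ ⊕_{x ∈ J_L} X_x^{a x}`, the `X_x` pairwise non-isomorphic indecomposables and
`a x ≥ 1`.  Then for every finite-dimensional `A`-module `M` (with indecomposable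
decomposition `M ≅ ⊕_j W j`), the multiplicity of `L` in `M` satisfies
`d_M(L) = dim Hom_A(L,M) - Σ_x a x · dim Hom_A(X_x, M) + dim Hom_A(C, M)`. -/
theorem multiplicity_formula_almost_split (k A : Type) [Field k] [IsAlgClosed k]
    [Ring A] [Algebra k A] [FiniteDimensional k A]
    (L Y C M : Type)
    [AddCommGroup L] [Module A L] [AddCommGroup Y] [Module A Y]
    [AddCommGroup C] [Module A C]
    [AddCommGroup M] [Module A M] [Module k M] [IsScalarTower k A M]
    [SMulCommClass A k M] [FiniteDimensional k M]
    (f : L →ₗ[A] Y) (g : Y →ₗ[A] C)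
    -- the sequence is short exact:
    (hf : Function.Injective f) (hg : Function.Surjective g)
    (hexact : LinearMap.range f = LinearMap.ker g)
    -- it does not split:
    (hnonsplit : ¬ ∃ s : C →ₗ[A] Y, g ∘ₗ s = LinearMap.id)
    -- its end terms are indecomposable:
    (hL : IsIndecomposableModule A L) (hC : IsIndecomposableModule A C)
    -- `f` is left almost split:
    (hleft : ∀ (Z : Type) [AddCommGroup Z] [Module A Z] (h : L →ₗ[A] Z),
      ¬ (∃ r : Z →ₗ[A] L, r ∘ₗ h = LinearMap.id) → ∃ u : Y →ₗ[A] Z, u ∘ₗ f = h)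
    -- `g` is right almost split:
    (hright : ∀ (Z : Type) [AddCommGroup Z] [Module A Z] (h : Z →ₗ[A] C),
      ¬ (∃ s : C →ₗ[A] Z, h ∘ₗ s = LinearMap.id) → ∃ u : Z →ₗ[A] Y, g ∘ₗ u = h)
    -- the indecomposable decomposition of the middle term `Y ≅ ⊕_x X_x^{a x}`:
    (ι : Type) [Fintype ι] (X : ι → Type)
    [∀ x, AddCommGroup (X x)] [∀ x, Module A (X x)]
    (a : ι → ℕ) (ha : ∀ x, 1 ≤ a x)
    (hXind : ∀ x, IsIndecomposableModule A (X x))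
    (hXne : ∀ x y, x ≠ y → IsEmpty (X x ≃ₗ[A] X y))
    (hY : Nonempty (Y ≃ₗ[A] (∀ x, Fin (a x) → X x)))
    -- an indecomposable decomposition of `M`:
    (m : ℕ) (W : Fin m → Type) [∀ j, AddCommGroup (W j)] [∀ j, Module A (W j)]
    (hW : ∀ j, IsIndecomposableModule A (W j))
    (hM : Nonempty (M ≃ₗ[A] (∀ j, W j))) :
    ((Finset.univ.filter (fun j => Nonempty (W j ≃ₗ[A] L))).card : ℤ)
      = Module.finrank k (L →ₗ[A] M)
        - ∑ x : ι, (a x : ℤ) * Module.finrank k (X x →ₗ[A] M)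
        + Module.finrank k (C →ₗ[A] M) := by
  let iL : Module k L := Module.compHom L (algebraMap k A)
  have tL : IsScalarTower k A L := ⟨fun c x y => by
    change (c • x) • y = algebraMap k A c • (x • y)
    rw [Algebra.smul_def, mul_smul]⟩
  have cL : SMulCommClass A k L := IsScalarTower.to_smulCommClass'
  have fC : Module.Finite A C := finite_right g hnonsplit hC hright
  have fL : Module.Finite A L := finite_left (k := k) f g hf hg hexact hnonsplit hleft
  have fY : Module.Finite A Y := by
    have e1 : Module.Finite A (LinearMap.ker g) := by
      rw [← hexact]; infer_instance
    have e2 : Module.Finite A (Y ⧸ LinearMap.ker g) :=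
      Module.Finite.equiv (LinearMap.quotKerEquivOfSurjective g hg).symm
    exact Module.Finite.of_submodule_quotient (LinearMap.ker g)
  obtain ⟨eY⟩ := hY
  have fX : ∀ x, Module.Finite A (X x) := by
    intro x
    refine Module.Finite.of_surjective
      ((LinearMap.proj (R := A) (φ := fun _ : Fin (a x) => X x) ⟨0, ha x⟩) ∘ₗ
        (LinearMap.proj (R := A) (φ := fun x => Fin (a x) → X x) x) ∘ₗ eY.toLinearMap) ?_
    exact (Function.surjective_eval (α := Fin (a x)) (β := fun _ => X x) ⟨0, ha x⟩).comp
      ((Function.surjective_eval (β := fun x => Fin (a x) → X x) x).comp eY.surjective)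
  have hfL : Module.Finite k (L →ₗ[A] M) := finite_hom k
  have hfY : Module.Finite k (Y →ₗ[A] M) := finite_hom k
  have hfX : ∀ x, Module.Finite k (X x →ₗ[A] M) := fun x => finite_hom k
  have fkL : FiniteDimensional k L := Module.Finite.trans A L
  have ntL : Nontrivial L := hL.1
  -- dimension of Hom(Y, M)
  have hdimY : Module.finrank k (Y →ₗ[A] M) = ∑ x : ι, a x * Module.finrank k (X x →ₗ[A] M) := by
    let e1 : (Y →ₗ[A] M) ≃ₗ[k] ((∀ x, Fin (a x) → X x) →ₗ[A] M) :=
      { toFun := fun h => h ∘ₗ eY.symm.toLinearMap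
        invFun := fun h => h ∘ₗ eY.toLinearMap
        map_add' := fun _ _ => rfl
        map_smul' := fun _ _ => rfl
        left_inv := fun h => by ext; simp
        right_inv := fun h => by
          apply LinearMap.ext; intro x; simp }
    let e2 := LinearMap.lsum A (fun x => Fin (a x) → X x) k (M := M)
    let e3 := fun x => LinearMap.lsum A (fun _ : Fin (a x) => X x) k (M := M)
    let e4 := LinearEquiv.piCongrRight e3
    rw [((e4.trans e2).trans e1.symm).finrank_eq.symm, Module.finrank_pi_fintype]
    refine Finset.sum_congr rfl fun x _ => ?_
    rw [Module.finrank_pi_fintype]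
    simp
  -- the functional
  obtain ⟨t, ht, hker⟩ := exists_functional (k := k) f
    (nonsplit_left f g hg hexact hnonsplit) hleft
  obtain ⟨eM⟩ := hM
  let J := {j : Fin m // Nonempty (W j ≃ₗ[A] L)}
  let e : ∀ j : J, W j.1 ≃ₗ[A] L := fun j => j.2.some
  let E : ∀ j : J, M →ₗ[A] L := fun j =>
    (e j).toLinearMap ∘ₗ (LinearMap.proj (R := A) (φ := W) j.1) ∘ₗ eM.toLinearMap
  let Ψ : (L →ₗ[A] M) →ₗ[k] (J → k) := LinearMap.pi fun j =>
    { toFun := fun h => t (E j ∘ₗ h)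
      map_add' := fun h h' => by rw [LinearMap.comp_add, map_add]
      map_smul' := fun c h => by
        have : E j ∘ₗ (c • h) = c • (E j ∘ₗ h) := by
          ext x
          exact LinearMap.map_smul_of_tower (E j) c (h x)
        rw [this, map_smul]; rfl }
  have hΨ : ∀ h j, Ψ h j = t (E j ∘ₗ h) := fun _ _ => rfl
  have hΨs : LinearMap.range Ψ = ⊤ := by
    rw [LinearMap.range_eq_top]
    intro c
    let h0 : L →ₗ[A] (∀ j, W j) := LinearMap.pi fun j =>
      if hj : Nonempty (W j ≃ₗ[A] L) then
        ((c ⟨j, hj⟩ * (t LinearMap.id)⁻¹) • LinearMap.id : L →ₗ[A] L) |> (e ⟨j, hj⟩).symm.toLinearMap.comp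
      else 0
    refine ⟨eM.symm.toLinearMap ∘ₗ h0, ?_⟩
    funext j
    rw [hΨ]
    have : E j ∘ₗ eM.symm.toLinearMap ∘ₗ h0 = (c j * (t LinearMap.id)⁻¹) • LinearMap.id := by
      ext x
      simp [E, h0, j.2]
      exact (e j).apply_symm_apply _
    rw [this, map_smul, smul_eq_mul, mul_assoc, inv_mul_cancel₀ ht, mul_one]
  have hΨk : LinearMap.ker Ψ = LinearMap.range (LinearMap.lcomp k M f) := by
    ext h
    rw [LinearMap.mem_ker, LinearMap.mem_range]
    constructor
    · intro h0
      have hj : ∀ j, ∃ u : Y →ₗ[A] W j,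
          u ∘ₗ f = (LinearMap.proj (R := A) (φ := W) j) ∘ₗ eM.toLinearMap ∘ₗ h := by
        intro j
        by_cases hj : Nonempty (W j ≃ₗ[A] L)
        · obtain ⟨u, hu⟩ := (hker _).1 ((hΨ h ⟨j, hj⟩).symm.trans (congr_fun h0 _))
          refine ⟨(e ⟨j, hj⟩).symm.toLinearMap ∘ₗ u, ?_⟩
          rw [LinearMap.comp_assoc, hu]
          ext x
          simp [E]
        · apply hleft
          rintro ⟨r, hr⟩
          have hinj := aux_retract (hW j) hL.1 _ _ hr
          have hsurj : Function.Surjective r := fun x => ⟨_, LinearMap.congr_fun hr x⟩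
          exact hj ⟨LinearEquiv.ofBijective r ⟨hinj, hsurj⟩⟩
      choose u hu using hj
      refine ⟨eM.symm.toLinearMap ∘ₗ LinearMap.pi u, ?_⟩
      apply LinearMap.ext
      intro x
      apply eM.injective
      funext j
      have := LinearMap.congr_fun (hu j) x
      simpa using this
    · rintro ⟨u, rfl⟩
      funext j
      rw [hΨ]
      exact (hker _).2 ⟨E j ∘ₗ u, rfl⟩
  have hkerf : LinearMap.ker (LinearMap.lcomp k M f) = LinearMap.range (LinearMap.lcomp k M g) := by
    ext h
    rw [LinearMap.mem_ker, LinearMap.mem_range]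
    constructor
    · intro h0
      have h0' : ∀ x, h (f x) = 0 := fun x => LinearMap.congr_fun h0 x
      let σ := (LinearMap.ker g).liftQ h (by
        rw [← hexact]
        rintro _ ⟨x, rfl⟩
        exact h0' x)
      refine ⟨σ ∘ₗ (LinearMap.quotKerEquivOfSurjective g hg).symm.toLinearMap, ?_⟩
      ext x
      have h1 : (LinearMap.quotKerEquivOfSurjective g hg).symm (g x) =
          (LinearMap.ker g).mkQ x := by
        rw [LinearEquiv.symm_apply_eq]; rfl
      simp [h1, σ]
    · rintro ⟨u, rfl⟩
      ext x
      have : g (f x) = 0 := by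
        have : f x ∈ LinearMap.ker g := hexact ▸ ⟨x, rfl⟩
        exact this
      simp [this]
  have hginj : Function.Injective (LinearMap.lcomp k M g) := by
    intro h h' hh
    ext c
    obtain ⟨y, rfl⟩ := hg c
    exact LinearMap.congr_fun hh y
  have d1 := LinearMap.finrank_range_add_finrank_ker Ψ
  have d2 := LinearMap.finrank_range_add_finrank_ker (LinearMap.lcomp k M f)
  have d3 := LinearMap.finrank_range_of_inj hginj
  rw [hΨs, finrank_top, Module.finrank_fintype_fun_eq_card, hΨk] at d1
  rw [hkerf, d3, hdimY] at d2
  have hcard : Fintype.card J = (Finset.univ.filter (fun j => Nonempty (W j ≃ₗ[A] L))).card := by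
    rw [Fintype.card_subtype]
  rw [hcard] at d1
  have d2' : ((Module.finrank k (LinearMap.range (LinearMap.lcomp k M f)) : ℤ)) +
      Module.finrank k (C →ₗ[A] M) = ∑ x : ι, (a x : ℤ) * Module.finrank k (X x →ₗ[A] M) := by
    exact_mod_cast d2
  rw [← d2', ← d1]
  push_cast
  ring
end

section
/- Let M be a Kronecker representation with dimension vector (d_1,d_2), λ ∈ k, and r_n(λ,M) := rank R_n(λ,M) where R_n(λ,M) is the n×n lower block bidiagonal matrix with λM(α)-M(β) on the diagonal blocks and M(α) on the subdiagonal blocks. Then the multiplicity of the regular indecomposable R_n(λ) = (E_n, J_n(λ)) in the decomposition of M equals r_{n-1}(λ,M) + r_{n+1}(λ,M) - 2r_n(λ,M) for n ≥ 2, and r_2(λ,M) - 2r_1(λ,M) for n = 1. -/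
/-- A (finite-dimensional) representation of the Kronecker quiver
`1 ⇉ 2`: two matrices between based vector spaces `k^{ι1} → k^{ι2}`. -/
structure KRep (k : Type) [Field k] where
  ι1 : Type
  ι2 : Type
  [f1 : Fintype ι1]
  [f2 : Fintype ι2]
  [e1 : DecidableEq ι1]
  [e2 : DecidableEq ι2]
  A : Matrix ι2 ι1 k
  B : Matrix ι2 ι1 k

attribute [instance] KRep.f1 KRep.f2 KRep.e1 KRep.e2

variable {k : Type} [Field k]

/-- Isomorphism of Kronecker representations: a pair of invertible matrices
intertwining the two structure matrices. -/
def KIso (M N : KRep k) : Prop :=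
  ∃ (S : Matrix N.ι1 M.ι1 k) (T : Matrix N.ι2 M.ι2 k)
    (S' : Matrix M.ι1 N.ι1 k) (T' : Matrix M.ι2 N.ι2 k),
    S * S' = 1 ∧ S' * S = 1 ∧ T * T' = 1 ∧ T' * T = 1 ∧
    T * M.A = N.A * S ∧ T * M.B = N.B * S

/-- Finite direct sum of Kronecker representations (block diagonal matrices). -/
def KSum {m : ℕ} (V : Fin m → KRep k) : KRep k where
  ι1 := Σ j, (V j).ι1
  ι2 := Σ j, (V j).ι2
  A := Matrix.blockDiagonal' (fun j => (V j).A)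
  B := Matrix.blockDiagonal' (fun j => (V j).B)

/-- The `n × n` Jordan cell with eigenvalue `lam`. -/
def jordanCell (n : ℕ) (lam : k) : Matrix (Fin n) (Fin n) k :=
  fun a b => if a = b then lam else if (a : ℕ) + 1 = (b : ℕ) then 1 else 0

/-- The preprojective indecomposable `P_n = ([E_{n-1}; 0], [0; E_{n-1}])`,
of dimension vector `(n-1, n)`. -/
def Prep (n : ℕ) : KRep k where
  ι1 := Fin (n - 1)
  ι2 := Fin n
  A := fun i j => if (i : ℕ) = (j : ℕ) then 1 else 0
  B := fun i j => if (i : ℕ) = (j : ℕ) + 1 then 1 else 0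

/-- The preinjective indecomposable `I_n = ([E_{n-1}, 0], [0, E_{n-1}])`,
of dimension vector `(n, n-1)`. -/
def Irep (n : ℕ) : KRep k where
  ι1 := Fin n
  ι2 := Fin (n - 1)
  A := fun i j => if (i : ℕ) = (j : ℕ) then 1 else 0
  B := fun i j => if (i : ℕ) + 1 = (j : ℕ) then 1 else 0

/-- The regular indecomposable `R_n(lam) = (E_n, J_n(lam))`. -/
def Rreg (n : ℕ) (lam : k) : KRep k where
  ι1 := Fin n
  ι2 := Fin n
  A := 1
  B := jordanCell n lam

/-- The regular indecomposable `R_n(∞) = (J_n(0), E_n)`. -/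
def Rinf (n : ℕ) : KRep k where
  ι1 := Fin n
  ι2 := Fin n
  A := jordanCell n 0
  B := 1

/-- `W` belongs to the list `𝓛` of indecomposable Kronecker representations. -/
def IsKroneckerIndec (W : KRep k) : Prop :=
  (∃ n, 1 ≤ n ∧ KIso W (Prep n)) ∨ (∃ n, 1 ≤ n ∧ KIso W (Irep n)) ∨
  (∃ n, 1 ≤ n ∧ ∃ lam : k, KIso W (Rreg n lam)) ∨ (∃ n, 1 ≤ n ∧ KIso W (Rinf n))

/-- The block matrix `R_n(lam, M)`: `n × n` lower block bidiagonal with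
`lam M(α) - M(β)` on the block diagonal and `M(α)` on the block subdiagonal. -/
def regularBlockMat (M : KRep k) (n : ℕ) (lam : k) :
    Matrix (Fin n × M.ι2) (Fin n × M.ι1) k :=
  fun rp cq =>
    if (rp.1 : ℕ) = (cq.1 : ℕ) then lam * M.A rp.2 cq.2 - M.B rp.2 cq.2
    else if (rp.1 : ℕ) = (cq.1 : ℕ) + 1 then M.A rp.2 cq.2 else 0

open Classical

section Helpers
open Matrix Kronecker

/-- lower shift -/
def lowShift (k : Type) [Field k] (n : ℕ) : Matrix (Fin n) (Fin n) k :=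
  Matrix.of fun i j => if (i : ℕ) = (j : ℕ) + 1 then 1 else 0

/-- the block matrix, for bare matrices -/
def bm {ι κ : Type} (A B : Matrix ι κ k) (n : ℕ) (lam : k) :
    Matrix (Fin n × ι) (Fin n × κ) k :=
  (1 : Matrix (Fin n) (Fin n) k) ⊗ₖ (lam • A - B) + lowShift k n ⊗ₖ A

lemma rbm_eq (M : KRep k) (n : ℕ) (lam : k) :
    regularBlockMat M n lam
      = (1 : Matrix (Fin n) (Fin n) k) ⊗ₖ (lam • M.A - M.B) + lowShift k n ⊗ₖ M.A := by
  ext ⟨i, p⟩ ⟨j, q⟩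
  simp only [regularBlockMat, lowShift, Matrix.add_apply, kronecker_apply, Matrix.one_apply,
    Matrix.sub_apply, Matrix.smul_apply, smul_eq_mul, Fin.ext_iff, Matrix.of_apply]
  split_ifs <;> first | omega | simp

lemma kiso_symm {M N : KRep k} (h : KIso M N) : KIso N M := by
  obtain ⟨S, T, S', T', h1, h2, h3, h4, h5, h6⟩ := h
  refine ⟨S', T', S, T, h2, h1, h4, h3, ?_, ?_⟩
  · calc T' * N.A = T' * (N.A * S) * S' := by
          rw [Matrix.mul_assoc, Matrix.mul_assoc, h1, Matrix.mul_one]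
      _ = M.A * S' := by rw [← h5, ← Matrix.mul_assoc, h4, Matrix.one_mul]
  · calc T' * N.B = T' * (N.B * S) * S' := by
          rw [Matrix.mul_assoc, Matrix.mul_assoc, h1, Matrix.mul_one]
      _ = M.B * S' := by rw [← h6, ← Matrix.mul_assoc, h4, Matrix.one_mul]

lemma rank_le_of_kiso {M N : KRep k} (h : KIso M N) (n : ℕ) (lam : k) :
    (regularBlockMat M n lam).rank ≤ (regularBlockMat N n lam).rank := by
  obtain ⟨S, T, S', T', h1, h2, h3, h4, h5, h6⟩ := h
  have hA : M.A = T' * N.A * S := by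
    rw [Matrix.mul_assoc, ← h5, ← Matrix.mul_assoc, h4, Matrix.one_mul]
  have hB : M.B = T' * N.B * S := by
    rw [Matrix.mul_assoc, ← h6, ← Matrix.mul_assoc, h4, Matrix.one_mul]
  have : regularBlockMat M n lam
      = ((1 : Matrix (Fin n) (Fin n) k) ⊗ₖ T') * regularBlockMat N n lam
        * ((1 : Matrix (Fin n) (Fin n) k) ⊗ₖ S) := by
    rw [rbm_eq, rbm_eq, Matrix.mul_add, Matrix.add_mul, ← mul_kronecker_mul, ← mul_kronecker_mul,
      ← mul_kronecker_mul, ← mul_kronecker_mul]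
    simp only [Matrix.one_mul, Matrix.mul_one]
    rw [hA, hB]
    congr 2
    rw [Matrix.mul_sub, Matrix.sub_mul, Matrix.mul_smul, Matrix.smul_mul]
  rw [this]
  exact (rank_mul_le_left _ _).trans (rank_mul_le_right _ _)

lemma rank_eq_of_kiso {M N : KRep k} (h : KIso M N) (n : ℕ) (lam : k) :
    (regularBlockMat M n lam).rank = (regularBlockMat N n lam).rank :=
  le_antisymm (rank_le_of_kiso h n lam) (rank_le_of_kiso (kiso_symm h) n lam)

lemma lowShift_pow (n r : ℕ) :
    lowShift k n ^ r = Matrix.of fun i j : Fin n => if (i : ℕ) = (j : ℕ) + r then (1 : k) else 0 := by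
  induction r with
  | zero => ext i j; simp [Matrix.one_apply, Fin.ext_iff]
  | succ r ih =>
    rw [pow_succ', ih]
    ext i j
    simp only [Matrix.mul_apply, lowShift, Matrix.of_apply, ite_mul, one_mul, zero_mul]
    by_cases h : (i : ℕ) = j + (r + 1)
    · rw [Finset.sum_eq_single (⟨j + r, by omega⟩ : Fin n)]
      · simp [h]; omega
      · intro b _ hb
        rw [if_neg]
        intro h'; apply hb; ext; simp; omega
      · simp
    · rw [if_neg h]
      apply Finset.sum_eq_zero
      intro b _
      split_ifs <;> first | omega | rfl

lemma lowShift_nil (n : ℕ) : lowShift k n ^ n = 0 := by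
  rw [lowShift_pow]; ext i j
  simp only [Matrix.zero_apply, Matrix.of_apply]
  rw [if_neg]; omega

lemma kron_pow {ι : Type} [Fintype ι] [DecidableEq ι] (n r : ℕ) (L : Matrix (Fin n) (Fin n) k)
    (X : Matrix ι ι k) : (L ⊗ₖ X) ^ r = (L ^ r) ⊗ₖ (X ^ r) := by
  induction r with
  | zero => simp
  | succ r ih => rw [pow_succ, pow_succ, pow_succ, ih, mul_kronecker_mul]

lemma isUnit_shift {ι : Type} [Fintype ι] [DecidableEq ι] (n : ℕ) (X : Matrix ι ι k) :
    IsUnit (1 + lowShift k n ⊗ₖ X) := by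
  apply IsNilpotent.isUnit_one_add
  exact ⟨n, by rw [kron_pow, lowShift_nil, zero_kronecker]⟩

lemma rank_of_left_inv {ι κ : Type} [Fintype ι] [Fintype κ] [DecidableEq ι] [DecidableEq κ]
    (A B : Matrix ι κ k) (lam : k) (C : Matrix κ ι k)
    (hC : C * (lam • A - B) = 1) (n : ℕ) :
    (bm A B n lam).rank = n * Fintype.card κ := by
  apply le_antisymm
  · simpa using rank_le_card_width (bm A B n lam)
  · have h := rank_of_isUnit _ (isUnit_shift n (C * A))
    have e : ((1 : Matrix (Fin n) (Fin n) k) ⊗ₖ C) * bm A B n lam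
        = 1 + lowShift k n ⊗ₖ (C * A) := by
      rw [bm, Matrix.mul_add, ← mul_kronecker_mul, ← mul_kronecker_mul, hC]
      simp
    rw [← e] at h
    have := rank_mul_le_right ((1 : Matrix (Fin n) (Fin n) k) ⊗ₖ C) (bm A B n lam)
    rw [h] at this
    simpa using this

lemma rank_of_right_inv {ι κ : Type} [Fintype ι] [Fintype κ] [DecidableEq ι] [DecidableEq κ]
    (A B : Matrix ι κ k) (lam : k) (C : Matrix κ ι k)
    (hC : (lam • A - B) * C = 1) (n : ℕ) :
    (bm A B n lam).rank = n * Fintype.card ι := by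
  apply le_antisymm
  · simpa using rank_le_card_height (bm A B n lam)
  · have h := rank_of_isUnit _ (isUnit_shift n (A * C))
    have e : bm A B n lam * ((1 : Matrix (Fin n) (Fin n) k) ⊗ₖ C)
        = 1 + lowShift k n ⊗ₖ (A * C) := by
      rw [bm, Matrix.add_mul, ← mul_kronecker_mul, ← mul_kronecker_mul, hC]
      simp
    rw [← e] at h
    have := rank_mul_le_left (bm A B n lam) ((1 : Matrix (Fin n) (Fin n) k) ⊗ₖ C)
    rw [h] at this
    simpa using this

lemma upper_inv (m : ℕ) (U : Matrix (Fin m) (Fin m) k) (c : k) (hc : c ≠ 0)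
    (hd : ∀ i, U i i = c) (hu : ∀ i j : Fin m, j < i → U i j = 0) : U⁻¹ * U = 1 := by
  apply Matrix.nonsing_inv_mul
  have : U.det = ∏ i, U i i := Matrix.det_of_isUpperTriangular (fun i j h => hu i j h)
  rw [this]
  simp only [hd]
  simp [hc]

/-- `lam A - B` for the preprojective representation -/
def pD (p : ℕ) (lam : k) : Matrix (Fin (p + 1)) (Fin p) k :=
  Matrix.of fun i j => lam * (if (i : ℕ) = (j : ℕ) then 1 else 0)
    - (if (i : ℕ) = (j : ℕ) + 1 then 1 else 0)

lemma pD_inv (p : ℕ) (lam : k) : ∃ C : Matrix (Fin p) (Fin (p + 1)) k, C * pD p lam = 1 := by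
  let U : Matrix (Fin p) (Fin p) k := (pD p lam).submatrix Fin.succ id
  have hU : U⁻¹ * U = 1 := by
    apply upper_inv p U (-1) (by simp)
    · intro i
      simp [U, pD]
    · intro i j h
      have : (j : ℕ) < i := h
      have h1 : ¬ ((i : ℕ) + 1 = j) := by omega
      have h2 : ¬ ((i : ℕ) = j) := by omega
      simp [U, pD, h1, h2]
  have e : U = ((1 : Matrix (Fin (p + 1)) (Fin (p + 1)) k).submatrix Fin.succ id) * pD p lam := by
    ext i j
    simp [U, Matrix.mul_apply, Matrix.one_apply]
  refine ⟨U⁻¹ * ((1 : Matrix (Fin (p + 1)) (Fin (p + 1)) k).submatrix Fin.succ id), ?_⟩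
  rw [Matrix.mul_assoc, ← e, hU]

lemma rank_Prep (p n : ℕ) (lam : k) :
    (regularBlockMat (Prep (p + 1)) n lam).rank = n * p := by
  obtain ⟨C, hC⟩ := pD_inv p lam
  have := rank_of_left_inv (ι := Fin (p + 1)) (κ := Fin p)
    (Prep (k := k) (p + 1)).A (Prep (k := k) (p + 1)).B lam C hC n
  rw [Fintype.card_fin] at this
  rw [rbm_eq]
  exact this

lemma rank_Irep (p n : ℕ) (lam : k) :
    (regularBlockMat (Irep (p + 1)) n lam).rank = n * p := by
  obtain ⟨C, hC⟩ := pD_inv p lam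
  let A : Matrix (Fin p) (Fin (p + 1)) k :=
    Matrix.of fun i j => if (i : ℕ) = (j : ℕ) then 1 else 0
  let B : Matrix (Fin p) (Fin (p + 1)) k :=
    Matrix.of fun i j => if (i : ℕ) + 1 = (j : ℕ) then 1 else 0
  have hD : lam • A - B = (pD p lam)ᵀ := by
    ext i j
    simp only [A, B, pD, Matrix.sub_apply, Matrix.smul_apply, Matrix.transpose_apply,
      Matrix.of_apply, smul_eq_mul, @eq_comm ℕ (j : ℕ)]
  have := rank_of_right_inv A B lam Cᵀ (by
      rw [hD, ← Matrix.transpose_mul, hC, Matrix.transpose_one]) n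
  rw [Fintype.card_fin] at this
  rw [rbm_eq]
  exact this

lemma rank_Rinf (m n : ℕ) (lam : k) :
    (regularBlockMat (Rinf m) n lam).rank = n * m := by
  have hU := upper_inv m (lam • (jordanCell m 0 : Matrix (Fin m) (Fin m) k) - 1) (-1) (by simp)
    (by intro i; simp [jordanCell])
    (by
      intro i j h
      have h' : (j : ℕ) < i := h
      have h1 : i ≠ j := h.ne'
      have h2 : ¬ ((i : ℕ) + 1 = j) := by omega
      simp [jordanCell, h1, h2])
  have := rank_of_left_inv _ _ lam _ hU n
  rw [Fintype.card_fin] at this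
  rw [rbm_eq]
  exact this

lemma rank_Rreg_ne (m n : ℕ) (lam mu : k) (hne : lam ≠ mu) :
    (regularBlockMat (Rreg m mu) n lam).rank = n * m := by
  have hU := upper_inv m (lam • (1 : Matrix (Fin m) (Fin m) k) - jordanCell m mu) (lam - mu)
    (sub_ne_zero.2 hne)
    (by intro i; simp [jordanCell])
    (by
      intro i j h
      have h' : (j : ℕ) < i := h
      have h1 : i ≠ j := h.ne'
      have h2 : ¬ ((i : ℕ) + 1 = j) := by omega
      simp [jordanCell, h1, h2])
  have := rank_of_left_inv _ _ lam _ hU n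
  rw [Fintype.card_fin] at this
  rw [rbm_eq]
  exact this

lemma rank_add_ker {ι κ : Type} [Fintype ι] [Fintype κ] (A : Matrix ι κ k) :
    A.rank + Module.finrank k (LinearMap.ker A.mulVecLin) = Fintype.card κ := by
  rw [Matrix.rank, LinearMap.finrank_range_add_finrank_ker, Module.finrank_pi]

/-- explicit block matrix for `R_m(lam)` -/
def Qmat (k : Type) [Field k] (m n : ℕ) : Matrix (Fin n × Fin m) (Fin n × Fin m) k :=
  Matrix.of fun x y => (if (x.1 : ℕ) = y.1 + 1 ∧ (x.2 : ℕ) = y.2 then 1 else 0)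
          - (if (x.1 : ℕ) = y.1 ∧ (x.2 : ℕ) + 1 = y.2 then 1 else 0)

lemma rank_Rreg_Q (m n : ℕ) (lam : k) :
    (regularBlockMat (Rreg m lam) n lam).rank = (Qmat k m n).rank := by
  have e : bm (1 : Matrix (Fin m) (Fin m) k) (jordanCell m lam) n lam = Qmat k m n := by
    ext ⟨i, a⟩ ⟨j, b⟩
    simp only [bm, Qmat, lowShift, jordanCell, Matrix.add_apply, kronecker_apply, Matrix.one_apply,
      Matrix.sub_apply, Matrix.smul_apply, smul_eq_mul, Fin.ext_iff, Matrix.of_apply]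
    split_ifs <;> first | omega | simp
  rw [← e, rbm_eq]
  rfl

/-- coordinate entry of the block matrix of `R_m(lam)` applied to a vector -/
lemma rbm_Rreg_mulVec (m n : ℕ) (x : Fin n × Fin m → k) (i : Fin n) (a : Fin m) :
    (Qmat k m n *ᵥ x) (i, a)
      = (if h : 1 ≤ (i : ℕ) then x (⟨i - 1, by omega⟩, a) else 0)
        - (if h : (a : ℕ) + 1 < m then x (i, ⟨a + 1, h⟩) else 0) := by
  simp only [Matrix.mulVec, dotProduct, Qmat, Matrix.of_apply, sub_mul, Finset.sum_sub_distrib, ite_mul, one_mul,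
    zero_mul]
  congr 1
  · split_ifs with h
    · rw [Finset.sum_eq_single ((⟨i - 1, by omega⟩, a) : Fin n × Fin m)]
      · rw [if_pos]; simp; omega
      · rintro ⟨j, b⟩ _ hb
        rw [if_neg]
        rintro ⟨h1, h2⟩
        apply hb
        ext <;> simp_all
      · simp
    · apply Finset.sum_eq_zero
      intro y _
      rw [if_neg]; omega
  · split_ifs with h
    · rw [Finset.sum_eq_single ((i, ⟨a + 1, h⟩) : Fin n × Fin m)]
      · rw [if_pos]; simp
      · rintro ⟨j, b⟩ _ hb
        rw [if_neg]
        rintro ⟨h1, h2⟩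
        apply hb
        ext <;> simp_all
      · simp
    · apply Finset.sum_eq_zero
      rintro ⟨j, b⟩ _
      rw [if_neg]; simp; omega

/-- parametrization of the kernel -/
def kerPar (k : Type) [Field k] (m n : ℕ) :
    (Fin (min (n + 1) m) → k) →ₗ[k] (Fin (n + 1) × Fin m → k) where
  toFun y := fun p =>
    if h : (p.2 : ℕ) + (n - p.1) < min (n + 1) m then y ⟨p.2 + (n - p.1), h⟩ else 0
  map_add' y z := by
    ext p; simp only [Pi.add_apply]; split_ifs <;> simp
  map_smul' c y := by
    ext p; simp only [Pi.smul_apply, RingHom.id_apply]; split_ifs <;> simp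

lemma kerPar_inj (m n : ℕ) : Function.Injective (kerPar k m n) := by
  intro y z h
  ext t
  have := congrFun h (⟨n, by omega⟩, ⟨t, by omega⟩)
  have h1 : (t : ℕ) ≤ n := by omega
  have h2 : (t : ℕ) < m := by omega
  simpa [kerPar, lt_min_iff, h1, h2] using this

lemma kerPar_range (m n : ℕ) :
    LinearMap.range (kerPar k m n) = LinearMap.ker (Qmat k m (n + 1)).mulVecLin := by
  ext x
  rw [LinearMap.mem_ker, Matrix.mulVecLin_apply]
  constructor
  · rintro ⟨y, rfl⟩
    ext ⟨i, a⟩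
    rw [rbm_Rreg_mulVec]
    simp only [kerPar, LinearMap.coe_mk, AddHom.coe_mk, Pi.zero_apply, sub_eq_zero]
    have hi := i.2
    have ha := a.2
    split_ifs <;> first | rfl | omega | (congr 2; omega)
  · intro hx
    have key : ∀ (i : Fin (n + 1)) (a : Fin m), (if h : 1 ≤ (i : ℕ) then x (⟨i - 1, by omega⟩, a) else 0)
        = (if h : (a : ℕ) + 1 < m then x (i, ⟨a + 1, h⟩) else 0) := by
      intro i a
      have := congrFun hx (i, a)
      rw [rbm_Rreg_mulVec] at this
      exact sub_eq_zero.1 this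
    -- vanishing below
    have hz : ∀ (i a : ℕ) (hi : i < n + 1) (ha : a < m), i < a → x (⟨i, hi⟩, ⟨a, ha⟩) = 0 := by
      intro i
      induction i with
      | zero =>
        intro a hi ha h
        have := key ⟨0, hi⟩ ⟨a - 1, by omega⟩
        rw [dif_neg (by simp), dif_pos (by simp; omega)] at this
        rw [this]
        congr 3; simp; omega
      | succ i ih =>
        intro a hi ha h
        have := key ⟨i + 1, hi⟩ ⟨a - 1, by omega⟩
        rw [dif_pos (by simp), dif_pos (by simp; omega)] at this
        have h2 := ih (a - 1) (by omega) (by omega) (by omega)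
        have h3 : x (⟨i + 1, hi⟩, ⟨a, ha⟩) = x (⟨i + 1, hi⟩, ⟨a - 1 + 1, by omega⟩) := by
          congr 3; omega
        rw [h3]
        exact this.symm.trans h2
    have hd : ∀ (s i a : ℕ) (hi : i + s = n) (ha : a < m),
        x (⟨i, by omega⟩, ⟨a, ha⟩)
          = if h : a + s < m then x (⟨n, by omega⟩, ⟨a + s, h⟩) else 0 := by
      intro s
      induction s with
      | zero =>
        intro i a hi ha
        have : i = n := by omega
        subst this
        simp [ha]
      | succ s ih =>
        intro i a hi ha
        have := key ⟨i + 1, by omega⟩ ⟨a, ha⟩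
        rw [dif_pos (by simp)] at this
        refine (show x (⟨i, by omega⟩, ⟨a, ha⟩) = _ from this).trans ?_
        by_cases h : a + 1 < m
        · rw [dif_pos h]
          refine (ih (i + 1) (a + 1) (by omega) h).trans ?_
          split_ifs <;> first | rfl | omega | (congr 3; omega)
        · rw [dif_neg h, dif_neg (by omega)]
    refine ⟨fun t => x (⟨n, by omega⟩, ⟨t, by omega⟩), ?_⟩
    ext ⟨i, a⟩
    simp only [kerPar, LinearMap.coe_mk, AddHom.coe_mk]
    rw [show x (i, a) = _ from hd (n - i) i a (by omega) a.2]
    split_ifs with h1 h2 h2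
    · rfl
    · omega
    · symm; apply hz; omega
    · rfl

lemma rank_Rreg_self (m n : ℕ) (lam : k) :
    (regularBlockMat (Rreg m lam) (n + 1) lam).rank + min (n + 1) m = (n + 1) * m := by
  have h := rank_add_ker (Qmat k m (n + 1))
  rw [← kerPar_range, LinearMap.finrank_range_of_inj (kerPar_inj m n), Module.finrank_pi] at h
  rw [rank_Rreg_Q]
  simpa using h

/-- explicit block matrix for a direct sum -/
def Smat {m : ℕ} (V : Fin m → KRep k) (n : ℕ) (lam : k) :
    Matrix (Fin n × (Σ j, (V j).ι2)) (Fin n × (Σ j, (V j).ι1)) k :=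
  Matrix.of fun rp cq =>
    if (rp.1 : ℕ) = (cq.1 : ℕ) then lam * Matrix.blockDiagonal' (fun j => (V j).A) rp.2 cq.2
      - Matrix.blockDiagonal' (fun j => (V j).B) rp.2 cq.2
    else if (rp.1 : ℕ) = (cq.1 : ℕ) + 1 then Matrix.blockDiagonal' (fun j => (V j).A) rp.2 cq.2
    else 0

lemma rbm_sum_mulVec {m : ℕ} (V : Fin m → KRep k) (n : ℕ) (lam : k)
    (x : Fin n × (Σ j, (V j).ι1) → k) (i : Fin n) (j : Fin m) (p : (V j).ι2) :
    (Smat V n lam *ᵥ x) (i, ⟨j, p⟩)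
      = (regularBlockMat (V j) n lam *ᵥ (fun y => x (y.1, ⟨j, y.2⟩))) (i, p) := by
  simp only [Matrix.mulVec, dotProduct, Fintype.sum_prod_type, Fintype.sum_sigma]
  apply Finset.sum_congr rfl
  intro i' _
  rw [Finset.sum_eq_single j]
  · apply Finset.sum_congr rfl
    intro q _
    simp [regularBlockMat, Smat]
  · intro j' _ hj
    apply Finset.sum_eq_zero
    intro q _
    simp [Smat, Matrix.blockDiagonal'_apply_ne _ _ _ hj.symm]
  · simp

/-- kernel of the block matrix of a direct sum -/
noncomputable def kerSumEquiv {m : ℕ} (V : Fin m → KRep k) (n : ℕ) (lam : k) :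
    LinearMap.ker (Smat V n lam).mulVecLin
    ≃ₗ[k] (∀ j, LinearMap.ker (regularBlockMat (V j) n lam).mulVecLin) where
  toFun x := fun j => ⟨fun y => x.1 (y.1, ⟨j, y.2⟩), by
    rw [LinearMap.mem_ker, Matrix.mulVecLin_apply]
    ext ⟨i, p⟩
    rw [← rbm_sum_mulVec]
    have := x.2
    rw [LinearMap.mem_ker, Matrix.mulVecLin_apply] at this
    rw [this]; rfl⟩
  invFun z := ⟨fun y => (z y.2.1).1 (y.1, y.2.2), by
    rw [LinearMap.mem_ker, Matrix.mulVecLin_apply]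
    ext ⟨i, j, p⟩
    rw [rbm_sum_mulVec]
    have := (z j).2
    rw [LinearMap.mem_ker, Matrix.mulVecLin_apply] at this
    exact congrFun this (i, p)⟩
  map_add' x y := rfl
  map_smul' c x := rfl
  left_inv x := rfl
  right_inv z := rfl

lemma rank_sum {m : ℕ} (V : Fin m → KRep k) (n : ℕ) (lam : k) :
    (regularBlockMat (KSum V) n lam).rank = ∑ j, (regularBlockMat (V j) n lam).rank := by
  change (Smat V n lam).rank = _
  have h := rank_add_ker (Smat V n lam)
  rw [(kerSumEquiv V n lam).finrank_eq, Module.finrank_pi_fintype, Fintype.card_prod,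
    Fintype.card_sigma, Finset.mul_sum] at h
  have h2 : ∑ j, ((regularBlockMat (V j) n lam).rank
      + Module.finrank k (LinearMap.ker (regularBlockMat (V j) n lam).mulVecLin))
      = ∑ j, Fintype.card (Fin n) * Fintype.card (V j).ι1 := by
    apply Finset.sum_congr rfl
    intro j _
    rw [rank_add_ker, Fintype.card_prod]
  rw [Finset.sum_add_distrib, ← h] at h2
  exact (Nat.add_right_cancel h2).symm

/-- second difference, for the index `n + 1`, with the convention `r_0 = 0` -/
noncomputable def secDiff (W : KRep k) (lam : k) (n : ℕ) : ℤ :=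
  (if n = 0 then 0 else ((regularBlockMat W n lam).rank : ℤ))
    + (regularBlockMat W (n + 2) lam).rank - 2 * (regularBlockMat W (n + 1) lam).rank

lemma secDiff_kiso {M N : KRep k} (h : KIso M N) (lam : k) (n : ℕ) :
    secDiff M lam n = secDiff N lam n := by
  simp only [secDiff, rank_eq_of_kiso h]

lemma secDiff_Rreg (m : ℕ) (hm : 1 ≤ m) (lam : k) (n : ℕ) :
    secDiff (Rreg m lam) lam n = if m = n + 1 then 1 else 0 := by
  have h1 := rank_Rreg_self m n lam
  have h2 := rank_Rreg_self m (n + 1) lam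
  unfold secDiff
  zify at h1 h2
  rcases n with _ | n
  · simp only [if_true]
    split_ifs with h
    · subst h; simp at h1 h2 ⊢; omega
    · rw [min_eq_left (by omega)] at h1 h2
      push_cast at h1 h2 ⊢
      linarith
  · have h0 := rank_Rreg_self m n lam
    zify at h0
    rw [if_neg (by omega)]
    have e1 : ((regularBlockMat (Rreg m lam) (n + 1) lam).rank : ℤ)
      = (n + 1) * m - min ((n : ℤ) + 1) m := by linarith
    have e2 : ((regularBlockMat (Rreg m lam) (n + 1 + 1) lam).rank : ℤ)
      = (n + 1 + 1) * m - min ((n : ℤ) + 1 + 1) m := by push_cast at h1; linarith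
    have e3 : ((regularBlockMat (Rreg m lam) (n + 1 + 2) lam).rank : ℤ)
      = (n + 1 + 1 + 1) * m - min ((n : ℤ) + 1 + 1 + 1) m := by push_cast at h2; linarith
    rw [e1, e2, e3]
    have : (if m = n + 1 + 1 then (1 : ℤ) else 0)
      = - min ((n : ℤ) + 1) m - min ((n : ℤ) + 1 + 1 + 1) m + 2 * min ((n : ℤ) + 1 + 1) m := by
      split_ifs <;> omega
    rw [this]; ring

lemma secDiff_lin (W : KRep k) (lam : k) (c : ℕ)
    (h : ∀ n, (regularBlockMat W n lam).rank = n * c) (n : ℕ) : secDiff W lam n = 0 := by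
  simp only [secDiff, h]
  split_ifs with h0
  · subst h0; push_cast; ring
  · push_cast; ring

lemma secDiff_indec (W : KRep k) (hW : IsKroneckerIndec W) (lam : k) (n : ℕ) :
    secDiff W lam n = if KIso W (Rreg (n + 1) lam) then 1 else 0 := by
  by_cases hi : KIso W (Rreg (n + 1) lam)
  · rw [if_pos hi, secDiff_kiso hi, secDiff_Rreg _ (by omega), if_pos rfl]
  · rw [if_neg hi]
    rcases hW with ⟨m, hm, h⟩ | ⟨m, hm, h⟩ | ⟨m, hm, mu, h⟩ | ⟨m, hm, h⟩
    · obtain ⟨p, rfl⟩ := Nat.exists_eq_add_of_le' hm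
      rw [secDiff_kiso h]
      exact secDiff_lin _ _ p (fun r => rank_Prep p r lam) n
    · obtain ⟨p, rfl⟩ := Nat.exists_eq_add_of_le' hm
      rw [secDiff_kiso h]
      exact secDiff_lin _ _ p (fun r => rank_Irep p r lam) n
    · by_cases hl : lam = mu
      · subst hl
        rw [secDiff_kiso h, secDiff_Rreg _ hm, if_neg]
        rintro rfl
        exact hi h
      · rw [secDiff_kiso h]
        exact secDiff_lin _ _ m (fun r => rank_Rreg_ne m r lam mu hl) n
    · rw [secDiff_kiso h]
      exact secDiff_lin _ _ m (fun r => rank_Rinf m r lam) n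

lemma secDiff_sum {m : ℕ} (V : Fin m → KRep k) (lam : k) (n : ℕ) :
    secDiff (KSum V) lam n = ∑ j, secDiff (V j) lam n := by
  simp only [secDiff, rank_sum, Finset.sum_sub_distrib, Finset.sum_add_distrib, ← Finset.mul_sum]
  split_ifs <;> simp

lemma count_eq (M : KRep k) (m : ℕ) (V : Fin m → KRep k) (hV : ∀ j, IsKroneckerIndec (V j))
    (hiso : KIso M (KSum V)) (lam : k) (n : ℕ) :
    ((Finset.univ.filter (fun j => KIso (V j) (Rreg (n + 1) lam))).card : ℤ)
      = secDiff M lam n := by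
  rw [secDiff_kiso hiso, secDiff_sum, Finset.card_filter]
  push_cast
  exact Finset.sum_congr rfl (fun j _ => (secDiff_indec _ (hV j) lam n).symm)

end Helpers

/-- if the Kronecker representation `M` decomposes as `⊕_j V j` with each
`V j` an indecomposable Kronecker representation, then with
`r_n(lam, M) = rank R_n(lam, M)`, the multiplicity of the regular indecomposable
`R_n(lam) = (E_n, J_n(lam))` equals
`r_{n-1}(lam,M) + r_{n+1}(lam,M) - 2 r_n(lam,M)` for `n ≥ 2`, and
`r_2(lam,M) - 2 r_1(lam,M)` for `n = 1`. -/
theorem kronecker_regular_multiplicity [IsAlgClosed k] (M : KRep k)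
    (m : ℕ) (V : Fin m → KRep k) (hV : ∀ j, IsKroneckerIndec (V j))
    (hiso : KIso M (KSum V)) (lam : k) (n : ℕ) :
    (2 ≤ n → ((Finset.univ.filter (fun j => KIso (V j) (Rreg n lam))).card : ℤ)
        = ((regularBlockMat M (n - 1) lam).rank : ℤ)
          + ((regularBlockMat M (n + 1) lam).rank : ℤ)
          - 2 * ((regularBlockMat M n lam).rank : ℤ)) ∧
    (n = 1 → ((Finset.univ.filter (fun j => KIso (V j) (Rreg n lam))).card : ℤ)
        = ((regularBlockMat M 2 lam).rank : ℤ)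
          - 2 * ((regularBlockMat M 1 lam).rank : ℤ)) := by
  constructor
  · intro hn
    obtain ⟨p, rfl⟩ := Nat.exists_eq_add_of_le' (show 1 ≤ n by omega)
    rw [count_eq M m V hV hiso lam p, secDiff, if_neg (by omega)]
    rfl
  · rintro rfl
    have := count_eq M m V hV hiso lam 0
    rw [this, secDiff, if_pos rfl]
    ring
end
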